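/- Let p ∈ ℝ[x₁,…,xₙ] be a real-zero polynomial of degree d such that p^r = det(I − 𝓜) for some r > 0 and some symmetric linear matrix polynomial 𝓜 of size r·d. Then the determinant of the parametrized Hermite matrix, det 𝓗(p) ∈ ℝ[x₁,…,xₙ], is a sum of squares of polynomials, i.e. det 𝓗(p) = Σ_{i=1}^m g_i² for some g₁,…,g_m ∈ ℝ[x₁,…,xₙ]. -/

import Mathlib

open Matrix

/-- Write `p = Σ_{i=0}^d p_i` with `p_i` homogeneous of degree `i`, and let
`P(x,t) = Σ_{i=0}^d p_i t^{d-i}` be the homogenization of `p` with respect to `t`.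
This is the companion matrix `L_t` of `P` (as a monic polynomial in `t` of degree `d`):
subdiagonal entries `1`, last column `(-p_d, -p_{d-1}, …, -p_1)ᵀ`. -/
noncomputable def companionM {n : ℕ} (d : ℕ) (p : MvPolynomial (Fin n) ℝ) :
    Matrix (Fin d) (Fin d) (MvPolynomial (Fin n) ℝ) := fun i j =>
  if (j : ℕ) = d - 1 then -(MvPolynomial.homogeneousComponent (d - (i : ℕ)) p)
  else if (i : ℕ) = (j : ℕ) + 1 then 1 else 0

/-- The parametrized Hermite matrix `𝓗(p)` of `p` (for `p` of degree `d`): the `d × d`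
matrix over `ℝ[x₁,…,xₙ]` whose `(i,j)`-entry (1-based) is the Newton sum
`N_{i+j-2}(P) = trace (L_t^{i+j-2})`. -/
noncomputable def hermiteM {n : ℕ} (d : ℕ) (p : MvPolynomial (Fin n) ℝ) :
    Matrix (Fin d) (Fin d) (MvPolynomial (Fin n) ℝ) := fun i j =>
  Matrix.trace (companionM d p ^ ((i : ℕ) + (j : ℕ)))

/-- A polynomial `p ∈ ℝ[x₁,…,xₙ]` with `p(0) = 1` is a real-zero polynomial if for every
`a ∈ ℝⁿ` all complex roots of the univariate polynomial `t ↦ p(ta)` are real. -/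
def IsRealZero {n : ℕ} (p : MvPolynomial (Fin n) ℝ) : Prop :=
  MvPolynomial.constantCoeff p = 1 ∧
  ∀ (a : Fin n → ℝ) (z : ℂ),
    (MvPolynomial.aeval (fun i => z * algebraMap ℝ ℂ (a i))) p = 0 → z.im = 0

/-- The symmetric linear matrix polynomial `𝓜 = x₁M₁ + ⋯ + xₙMₙ` determined by
matrices `M₁, …, Mₙ`. -/
noncomputable def pencil {n k : ℕ} (M : Fin n → Matrix (Fin k) (Fin k) ℝ) :
    Matrix (Fin k) (Fin k) (MvPolynomial (Fin n) ℝ) := fun i j =>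
  ∑ l, MvPolynomial.X l * MvPolynomial.C (M l i j)

theorem Matrix.eval_charpoly_pow {S ι : Type*} [CommRing S] [IsDomain S] [Fintype ι]
    [DecidableEq ι] {k : ℕ} {ζ : S} (hk : 0 < k) (hζ : IsPrimitiveRoot ζ k) (A : Matrix ι ι S)
    (t : S) :
    (A ^ k).charpoly.eval (t ^ k) = (-1) ^ Fintype.card ι *
      ∏ i ∈ Finset.range k, (-1) ^ Fintype.card ι * A.charpoly.eval (ζ ^ i * t) := by
  have key : ∀ (B : Matrix ι ι S) (c : S),
      B.charpoly.eval c = (-1) ^ Fintype.card ι * (B - algebraMap S _ c).det := by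
    intro B c
    rw [Matrix.eval_charpoly, ← Matrix.det_neg, neg_sub]
    rfl
  have hdet : (A ^ k - algebraMap S _ (t ^ k)).det =
      ∏ i ∈ Finset.range k, (A - algebraMap S _ (ζ ^ i * t)).det := by
    have h := congrArg (fun q => (Polynomial.aeval A q).det)
      (X_pow_sub_C_eq_prod hζ hk (rfl : t ^ k = t ^ k))
    have hprod : ∀ s : Finset ℕ,
        (Polynomial.aeval A (∏ i ∈ s, (Polynomial.X - Polynomial.C (ζ ^ i * t)))).det =
          ∏ i ∈ s, (A - algebraMap S _ (ζ ^ i * t)).det := by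
      intro s
      induction s using Finset.induction_on with
      | empty => simp
      | insert i s hi ih =>
        rw [Finset.prod_insert hi, Finset.prod_insert hi, map_mul, Matrix.det_mul, ih, map_sub,
          Polynomial.aeval_X, Polynomial.aeval_C]
    rw [← hprod]
    simpa only [map_sub, map_pow, Polynomial.aeval_X, Polynomial.aeval_C] using h
  rw [key, hdet]
  congr 1
  refine Finset.prod_congr rfl fun i _ => ?_
  rw [key, ← mul_assoc, ← mul_pow]
  simp

theorem Matrix.expand_charpoly_pow {R ι : Type*} [CommRing R] [Fintype ι] [DecidableEq ι]
    (k : ℕ) (A : Matrix ι ι R) :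
    Polynomial.expand R k (A ^ k).charpoly =
      ((A.map Polynomial.C) ^ k).charpoly.eval (Polynomial.X ^ k) := by
  rw [← Matrix.map_pow, Matrix.charpoly_map, Polynomial.eval_map,
    Polynomial.expand_eq_comp_X_pow, Polynomial.comp]

theorem Matrix.charpoly_pow_pow_eq {R ι κ : Type*} [CommRing R] [IsDomain R] [Fintype ι]
    [DecidableEq ι] [Fintype κ] [DecidableEq κ] {k r : ℕ} {ζ : R} (hk : 0 < k)
    (hζ : IsPrimitiveRoot ζ k) (A : Matrix ι ι R) (B : Matrix κ κ R)
    (h : A.charpoly ^ r = B.charpoly) :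
    (A ^ k).charpoly ^ r = (B ^ k).charpoly := by
  have hcard : Fintype.card κ = Fintype.card ι * r := by
    rw [← B.charpoly_natDegree_eq_dim, ← h, A.charpoly_monic.natDegree_pow,
      A.charpoly_natDegree_eq_dim, mul_comm]
  have hC : IsPrimitiveRoot (Polynomial.C ζ) k := hζ.map_of_injective Polynomial.C_injective
  apply Polynomial.expand_injective hk
  rw [map_pow, Matrix.expand_charpoly_pow, Matrix.expand_charpoly_pow,
    Matrix.eval_charpoly_pow hk hC, Matrix.charpoly_map,
    Matrix.eval_charpoly_pow hk hC, Matrix.charpoly_map, ← h, hcard]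
  simp only [mul_pow, ← Finset.prod_pow, Polynomial.map_pow, Polynomial.eval_pow, pow_mul]

theorem Matrix.trace_pow_of_charpoly_pow_eq {R ι κ : Type*} [CommRing R] [IsDomain R] [Fintype ι]
    [DecidableEq ι] [Fintype κ] [DecidableEq κ] {k r : ℕ} {ζ : R} (hk : 0 < k)
    (hζ : IsPrimitiveRoot ζ k) (A : Matrix ι ι R) (B : Matrix κ κ R)
    (h : A.charpoly ^ r = B.charpoly) :
    r * (A ^ k).trace = (B ^ k).trace := by
  rw [Matrix.trace_eq_neg_charpoly_nextCoeff, Matrix.trace_eq_neg_charpoly_nextCoeff (B ^ k),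
    ← Matrix.charpoly_pow_pow_eq hk hζ A B h, (Matrix.charpoly_monic _).nextCoeff_pow]
  simp

theorem trace_pow_of_charpoly_pow_eq {σ ι κ : Type*} [Fintype ι] [DecidableEq ι] [Fintype κ]
    [DecidableEq κ] {r : ℕ} (A : Matrix ι ι (MvPolynomial σ ℝ)) (B : Matrix κ κ (MvPolynomial σ ℝ))
    (h : A.charpoly ^ r = B.charpoly) (k : ℕ) :
    r * (A ^ k).trace = (B ^ k).trace := by
  rcases Nat.eq_zero_or_pos k with rfl | hk
  · have hcard := congrArg Polynomial.natDegree h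
    rw [A.charpoly_monic.natDegree_pow, A.charpoly_natDegree_eq_dim,
      B.charpoly_natDegree_eq_dim] at hcard
    simp [← hcard]
  · set f : MvPolynomial σ ℝ →+* MvPolynomial σ ℂ := MvPolynomial.map (algebraMap ℝ ℂ)
    have hζ : IsPrimitiveRoot (MvPolynomial.C (σ := σ)
        (Complex.exp (2 * Real.pi * Complex.I / k))) k :=
      (Complex.isPrimitiveRoot_exp k hk.ne').map_of_injective (MvPolynomial.C_injective σ ℂ)
    have hf : Function.Injective f :=
      MvPolynomial.map_injective _ (algebraMap ℝ ℂ).injective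
    have := Matrix.trace_pow_of_charpoly_pow_eq (r := r) hk hζ (A.map f) (B.map f)
      (by rw [Matrix.charpoly_map, Matrix.charpoly_map, ← Polynomial.map_pow, h])
    apply hf
    rw [map_mul, map_natCast, AddMonoidHom.map_trace f, AddMonoidHom.map_trace f]
    simpa [Matrix.map_pow] using this

/-- A form of the Cauchy–Binet formula for Gram determinants, summing over all maps `ι → α`. -/
theorem Matrix.sum_det_submatrix_sq {R α ι : Type*} [CommRing R] [Fintype α] [Fintype ι]
    [DecidableEq ι] (A : Matrix α ι R) :
    ∑ f : ι → α, (A.submatrix f id).det ^ 2 = (Fintype.card ι).factorial * (Aᵀ * A).det := by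
  have hgram : (Aᵀ * A).det = ∑ f : ι → α, (∏ i, A (f i) i) * (A.submatrix f id).det := by
    have h1 : Aᵀ * A = fun i => ∑ a, A a i • A a := by
      ext i j
      simp [Matrix.mul_apply, Finset.sum_apply]
    have h2 := (Matrix.detRowAlternating (n := ι) (R := R)).toMultilinearMap.map_sum
      (fun i (a : α) => A a i • A a)
    rw [h1]
    refine h2.trans (Finset.sum_congr rfl fun f _ => ?_)
    exact MultilinearMap.map_smul_univ _ (fun i => A (f i) i) (fun i => A (f i))
  have hperm : ∀ σ : Equiv.Perm ι, ∑ f : ι → α,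
      (Equiv.Perm.sign σ : R) * (∏ i, A (f (σ i)) i) * (A.submatrix f id).det = (Aᵀ * A).det := by
    intro σ
    rw [hgram]
    refine Fintype.sum_equiv (Equiv.arrowCongr σ.symm (Equiv.refl α)) _ _ fun f => ?_
    have h : (A.submatrix (f ∘ σ) id).det = Equiv.Perm.sign σ * (A.submatrix f id).det :=
      Matrix.det_permute σ (A.submatrix f id)
    change _ = (∏ i, A (f (σ i)) i) * (A.submatrix (f ∘ σ) id).det
    rw [h]
    ring
  calc ∑ f : ι → α, (A.submatrix f id).det ^ 2
      = ∑ f : ι → α, ∑ σ : Equiv.Perm ι,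
          (Equiv.Perm.sign σ : R) * (∏ i, A (f (σ i)) i) * (A.submatrix f id).det := by
        refine Finset.sum_congr rfl fun f _ => ?_
        rw [← Finset.sum_mul, sq]
        congr 1
        simp [Matrix.det_apply']
    _ = _ := by
        rw [Finset.sum_comm, Finset.sum_congr rfl fun σ _ => hperm σ]
        simp [Fintype.card_perm]

theorem det_scalar_sub_companion {R : Type*} [CommRing R] (x : R) (m : ℕ) (c : Fin (m + 1) → R) :
    (Matrix.of fun i j : Fin (m + 1) => (if i = j then x else 0) -
      if (j : ℕ) = m then c i else if (i : ℕ) = j + 1 then 1 else 0).det =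
      x ^ (m + 1) - ∑ i, c i * x ^ (i : ℕ) := by
  induction m with
  | zero => simp
  | succ m ih =>
    have hfirst : ((Matrix.of fun i j : Fin (m + 2) => (if i = j then x else 0) -
        if (j : ℕ) = m + 1 then c i else if (i : ℕ) = j + 1 then 1 else 0).submatrix Fin.succ
          (Fin.succAbove 0)).det = x ^ (m + 1) - ∑ i : Fin (m + 1), c i.succ * x ^ (i : ℕ) := by
      rw [← ih]
      congr 1
      ext i j
      simp
    have hlast : ((Matrix.of fun i j : Fin (m + 2) => (if i = j then x else 0) -
        if (j : ℕ) = m + 1 then c i else if (i : ℕ) = j + 1 then 1 else 0).submatrix Fin.succ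
          (Fin.succAbove (Fin.last m).succ)).det = (-1) ^ (m + 1) := by
      rw [Matrix.det_of_isUpperTriangular]
      · rw [← Fin.prod_const]
        refine Finset.prod_congr rfl fun i _ => ?_
        simp [Fin.ext_iff, i.isLt.ne]
      · intro i j hij
        have hij' : (j : ℕ) < i := hij
        have h1 : ¬ (i : ℕ) + 1 = j := by omega
        have h2 : ¬ (j : ℕ) = m + 1 := by omega
        have h3 : ¬ (i : ℕ) = j := by omega
        simp [Fin.ext_iff, h1, h2, h3]
    have hs : ((-1 : R) ^ (m + 1)) * (-1) ^ (m + 1) = 1 := by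
      rw [← mul_pow]; simp
    rw [Matrix.det_succ_row_zero, Fin.sum_univ_succ, Fin.sum_univ_castSucc, hfirst,
      hlast, Finset.sum_eq_zero (s := Finset.univ (α := Fin m)),
      Fin.sum_univ_succ (n := m + 1)]
    · have hx : ∑ i : Fin (m + 1), c i.succ * x ^ ((i : ℕ) + 1) =
          x * ∑ i : Fin (m + 1), c i.succ * x ^ (i : ℕ) := by
        rw [Finset.mul_sum]
        exact Finset.sum_congr rfl fun i _ => by ring
      simp only [Matrix.of_apply, Fin.val_succ, Fin.val_last, Fin.val_zero, hx]
      simp [Fin.ext_iff]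
      linear_combination (-c 0) * hs
    · intro j _
      simp [Fin.ext_iff, j.isLt.ne]

theorem Polynomial.eq_of_natDegree_eq_of_reverse_eq {R : Type*} [CommRing R] {f g : Polynomial R}
    (hdeg : f.natDegree = g.natDegree) (h : f.reverse = g.reverse) : f = g := by
  rw [← Polynomial.reflect_reflect (N := f.natDegree) (p := f),
    ← Polynomial.reflect_reflect (N := g.natDegree) (p := g)]
  change Polynomial.reflect _ f.reverse = Polynomial.reflect _ g.reverse
  rw [h, hdeg]

theorem Polynomial.reverse_pow_of_domain {R : Type*} [CommRing R] [IsDomain R] (f : Polynomial R)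
    (r : ℕ) : (f ^ r).reverse = f.reverse ^ r := by
  induction r with
  | zero => simpa using Polynomial.reverse_C (1 : R)
  | succ r ih => rw [pow_succ, Polynomial.reverse_mul_of_domain, ih, pow_succ]

/-- The substitution `xᵢ ↦ T xᵢ`. -/
noncomputable def scaleVars (n : ℕ) :
    MvPolynomial (Fin n) ℝ →+* Polynomial (MvPolynomial (Fin n) ℝ) :=
  MvPolynomial.eval₂Hom (Polynomial.C.comp MvPolynomial.C)
    fun i => Polynomial.C (MvPolynomial.X i) * Polynomial.X

theorem scaleVars_of_isHomogeneous {n : ℕ} {q : MvPolynomial (Fin n) ℝ} {i : ℕ}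
    (hq : q.IsHomogeneous i) : scaleVars n q = Polynomial.C q * Polynomial.X ^ i := by
  have hmon : ∀ m ∈ q.support, scaleVars n (MvPolynomial.monomial m (q.coeff m)) =
      Polynomial.C (MvPolynomial.monomial m (q.coeff m)) * Polynomial.X ^ i := by
    intro m hm
    have hdeg : m.degree = i := by
      rw [Finsupp.degree_eq_weight_one]
      exact hq (MvPolynomial.mem_support_iff.1 hm)
    rw [scaleVars, MvPolynomial.eval₂Hom_monomial, Finsupp.prod, MvPolynomial.monomial_eq,
      ← hdeg, Finsupp.degree_apply, Finsupp.prod]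
    simp only [mul_pow, Finset.prod_mul_distrib, Finset.prod_pow_eq_pow_sum, map_mul, map_prod,
      map_pow, RingHom.comp_apply, mul_assoc]
  conv_lhs => rw [q.as_sum, map_sum, Finset.sum_congr rfl hmon, ← Finset.sum_mul, ← map_sum,
    ← q.as_sum]

theorem scaleVars_det_one_sub_pencil {n k : ℕ} (M : Fin n → Matrix (Fin k) (Fin k) ℝ) :
    scaleVars n (1 - pencil M).det = (pencil M).charpolyRev := by
  rw [Matrix.charpolyRev, RingHom.map_det]
  congr 1
  ext1 i j
  have hentry : scaleVars n (pencil M i j) = Polynomial.X * Polynomial.C (pencil M i j) := by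
    have : (pencil M i j).IsHomogeneous 1 :=
      MvPolynomial.IsHomogeneous.sum _ _ _ fun l _ =>
        (MvPolynomial.isHomogeneous_X ℝ l).mul (MvPolynomial.isHomogeneous_C _ _)
    rw [scaleVars_of_isHomogeneous this, pow_one, mul_comm]
  simp only [RingHom.mapMatrix_apply, Matrix.map_apply, Matrix.sub_apply, Matrix.smul_apply,
    map_sub, hentry, smul_eq_mul, Matrix.one_apply, map_one]

theorem charpoly_companionM {n d : ℕ} (p : MvPolynomial (Fin n) ℝ) :
    (companionM d p).charpoly = Polynomial.X ^ d + ∑ i : Fin d,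
      Polynomial.C (MvPolynomial.homogeneousComponent (d - i) p) * Polynomial.X ^ (i : ℕ) := by
  rcases d with _ | m
  · simp [Matrix.charpoly]
  · have h := det_scalar_sub_companion (Polynomial.X : Polynomial (MvPolynomial (Fin n) ℝ)) m
      fun i => Polynomial.C (-MvPolynomial.homogeneousComponent (m + 1 - i) p)
    have hsum : Polynomial.X ^ (m + 1) + ∑ i : Fin (m + 1),
        Polynomial.C (MvPolynomial.homogeneousComponent (m + 1 - i) p) * Polynomial.X ^ (i : ℕ) =
      Polynomial.X ^ (m + 1) - ∑ i : Fin (m + 1),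
        Polynomial.C (-MvPolynomial.homogeneousComponent (m + 1 - i) p) *
          Polynomial.X ^ (i : ℕ) := by
      rw [sub_eq_add_neg, ← Finset.sum_neg_distrib]
      congr 1
      refine Finset.sum_congr rfl fun i _ => ?_
      rw [Polynomial.C_neg]
      ring
    rw [hsum, ← h, Matrix.charpoly]
    congr 1
    ext1 i j
    rw [Matrix.charmatrix_apply, Matrix.diagonal_apply, Matrix.of_apply]
    congr 1
    simp only [companionM, Nat.add_sub_cancel]
    split_ifs <;> simp

theorem charpolyRev_companionM {n : ℕ} (p : MvPolynomial (Fin n) ℝ)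
    (hp : MvPolynomial.constantCoeff p = 1) :
    (companionM p.totalDegree p).charpolyRev = scaleVars n p := by
  have hscale : scaleVars n p = ∑ i ∈ Finset.range (p.totalDegree + 1),
      Polynomial.C (MvPolynomial.homogeneousComponent i p) * Polynomial.X ^ i := by
    conv_lhs => rw [← p.sum_homogeneousComponent, map_sum]
    exact Finset.sum_congr rfl fun i _ =>
      scaleVars_of_isHomogeneous (MvPolynomial.homogeneousComponent_isHomogeneous i p)
  have hzero : MvPolynomial.homogeneousComponent 0 p = 1 := by
    rw [MvPolynomial.homogeneousComponent_zero, ← MvPolynomial.constantCoeff_eq, hp, map_one]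
  have hchar : (companionM p.totalDegree p).charpoly =
      ∑ i ∈ Finset.range (p.totalDegree + 1), Polynomial.C
        (MvPolynomial.homogeneousComponent (p.totalDegree - i) p) * Polynomial.X ^ i := by
    rw [charpoly_companionM, Finset.sum_range_succ, Finset.sum_range, Nat.sub_self, hzero,
      map_one, one_mul, add_comm]
  rw [← Matrix.reverse_charpoly, Polynomial.reverse, Matrix.charpoly_natDegree_eq_dim,
    Fintype.card_fin, hscale, hchar]
  ext1 k
  rw [Polynomial.coeff_reflect]
  simp only [Polynomial.finsetSum_coeff, Polynomial.coeff_C_mul_X_pow, Finset.sum_ite_eq,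
    Finset.mem_range]
  rcases le_or_gt k p.totalDegree with hk | hk
  · rw [Polynomial.revAt_le hk, if_pos (by omega), if_pos (by omega), Nat.sub_sub_self hk]
  · rw [Polynomial.revAt_eq_self_of_lt hk, if_neg (by omega), if_neg (by omega)]

theorem charpoly_companionM_pow {n d r : ℕ} {p : MvPolynomial (Fin n) ℝ}
    (hp : MvPolynomial.constantCoeff p = 1) (hdeg : p.totalDegree = d)
    {M : Fin n → Matrix (Fin (r * d)) (Fin (r * d)) ℝ} (hdet : p ^ r = (1 - pencil M).det) :
    (companionM d p).charpoly ^ r = (pencil M).charpoly := by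
  subst hdeg
  apply Polynomial.eq_of_natDegree_eq_of_reverse_eq
  · rw [(Matrix.charpoly_monic _).natDegree_pow, Matrix.charpoly_natDegree_eq_dim,
      Matrix.charpoly_natDegree_eq_dim, Fintype.card_fin, Fintype.card_fin]
  · rw [Polynomial.reverse_pow_of_domain, Matrix.reverse_charpoly, Matrix.reverse_charpoly,
      charpolyRev_companionM p hp, ← map_pow, hdet, scaleVars_det_one_sub_pencil]

theorem pencil_isSymm {n k : ℕ} {M : Fin n → Matrix (Fin k) (Fin k) ℝ}
    (hsymm : ∀ l, (M l).IsSymm) : (pencil M).IsSymm := by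
  ext1 i j
  simp only [Matrix.transpose_apply, pencil, (hsymm _).apply]

/-- The matrix whose `i`-th column lists the entries of `B ^ i`. -/
def powerColumns {R ι : Type*} [CommRing R] [Fintype ι] [DecidableEq ι] (B : Matrix ι ι R) (d : ℕ) :
    Matrix (ι × ι) (Fin d) R := fun a i => (B ^ (i : ℕ)) a.1 a.2

theorem powerColumns_gram {R ι : Type*} [CommRing R] [Fintype ι] [DecidableEq ι]
    {B : Matrix ι ι R} (hB : B.IsSymm) (d : ℕ) (i j : Fin d) :
    ((powerColumns B d)ᵀ * powerColumns B d) i j = (B ^ ((i : ℕ) + j)).trace := by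
  rw [pow_add, Matrix.trace_mul_comm, Matrix.trace, Matrix.mul_apply, Fintype.sum_prod_type,
    Finset.sum_congr rfl]
  intro a _
  rw [Matrix.diag_apply, Matrix.mul_apply]
  refine Finset.sum_congr rfl fun b _ => ?_
  rw [(hB.pow i).apply a b, mul_comm]
  rfl

/-- Let `p` be a real-zero polynomial of degree `d` with `p^r = det(I - 𝓜)` for some `r > 0`
and a symmetric linear matrix polynomial `𝓜` of size `r·d`. Then `det 𝓗(p)` is a sum of
squares of polynomials. -/
theorem det_hermite_sos_of_detRep {n : ℕ} (p : MvPolynomial (Fin n) ℝ) (d : ℕ)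
    (hRZ : IsRealZero p) (hdeg : p.totalDegree = d) (r : ℕ) (hr : 0 < r)
    (M : Fin n → Matrix (Fin (r * d)) (Fin (r * d)) ℝ) (hsymm : ∀ l, (M l).IsSymm)
    (hdet : p ^ r = Matrix.det (1 - pencil M)) :
    ∃ (m : ℕ) (g : Fin m → MvPolynomial (Fin n) ℝ),
      Matrix.det (hermiteM d p) = ∑ i, g i ^ 2 := by
  have htrace := trace_pow_of_charpoly_pow_eq _ _ (charpoly_companionM_pow hRZ.1 hdeg hdet)
  set A := powerColumns (pencil M) d
  have hgram : (Aᵀ * A).det = MvPolynomial.C ((r : ℝ) ^ d) * (hermiteM d p).det := by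
    have : Aᵀ * A = MvPolynomial.C (σ := Fin n) (r : ℝ) • hermiteM d p := by
      ext1 i j
      rw [powerColumns_gram (pencil_isSymm hsymm), ← htrace, Matrix.smul_apply, smul_eq_mul,
        map_natCast]
      rfl
    rw [this, Matrix.det_smul, Fintype.card_fin, map_pow]
  have hsum := Matrix.sum_det_submatrix_sq A
  rw [hgram, Fintype.card_fin] at hsum
  set c : ℝ := ((d.factorial : ℝ) * (r : ℝ) ^ d)⁻¹ with hc
  have hc0 : 0 ≤ c := by positivity
  have hcne : (d.factorial : ℝ) * (r : ℝ) ^ d ≠ 0 := by positivity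
  let e := Fintype.equivFin (Fin d → Fin (r * d) × Fin (r * d))
  refine ⟨_, fun i => MvPolynomial.C (Real.sqrt c) * (A.submatrix (e.symm i) id).det, ?_⟩
  rw [Equiv.sum_comp e.symm fun f => (MvPolynomial.C (Real.sqrt c) * (A.submatrix f id).det) ^ 2]
  simp only [mul_pow, ← map_pow, Real.sq_sqrt hc0, ← Finset.mul_sum]
  rw [hsum, ← map_natCast (MvPolynomial.C (σ := Fin n) (R := ℝ)), ← mul_assoc, ← mul_assoc,
    ← map_mul, ← map_mul, mul_assoc, hc, inv_mul_cancel₀ hcne, map_one, one_mul]
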